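/- There exist infinitely many composite natural numbers n such that rad(φ(n)) divides n − 1 but n is not a Carmichael number; that is, the set of radimichael numbers that are not Carmichael numbers is infinite. -/

import Mathlib

/-- The radical of a natural number: the product of its distinct prime factors,
i.e. its largest squarefree divisor. -/
def rad (n : ℕ) : ℕ := ∏ p ∈ n.primeFactors, p

/-- A composite natural number `n` is a Carmichael number if `a ^ n ≡ a (mod n)`
for every integer `a`. -/
def IsCarmichael (n : ℕ) : Prop :=
  1 < n ∧ ¬ n.Prime ∧ ∀ a : ℤ, a ^ n ≡ a [ZMOD (n : ℤ)]

lemma summable_natCast_rpow_neg_one_add {ε : ℝ} (hε : 0 < ε) :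
    Summable fun n : ℕ ↦ (n : ℝ) ^ (-(1 + ε)) :=
  Real.summable_nat_rpow.mpr (by linarith)

lemma tsum_natCast_rpow_neg_one_add_le {ε : ℝ} (hε : 0 < ε) (hε1 : ε ≤ 1) :
    ∑' n : ℕ, (n : ℝ) ^ (-(1 + ε)) ≤ 2 / ε := by
  have key (N : ℕ) : ∑ n ∈ Finset.range N, ((n + 1 + 1 : ℕ) : ℝ) ^ (-(1 + ε)) ≤
      1 / ε - ((N + 1 : ℕ) : ℝ) ^ (-ε) / ε := by
    have hanti : AntitoneOn (fun x : ℝ ↦ x ^ (-(1 + ε)))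
        (Set.Icc ((1 : ℕ) : ℝ) ((N + 1 : ℕ) : ℝ)) := by
      intro x hx y _ hxy
      have : (0 : ℝ) < x := by have := hx.1; push_cast at this; linarith
      exact Real.rpow_le_rpow_of_nonpos this hxy (by linarith)
    have h := hanti.sum_le_integral_Ico (a := 1) (b := N + 1) (by omega)
    rw [integral_rpow] at h
    · rw [Finset.sum_Ico_eq_sum_range] at h
      simp only [Nat.add_sub_cancel] at h
      calc _ = ∑ k ∈ Finset.range N, (((1 + k + 1 : ℕ) : ℝ)) ^ (-(1 + ε)) := by
            refine Finset.sum_congr rfl fun k _ ↦ ?_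
            rw [add_comm 1 k]
        _ ≤ _ := h
        _ = _ := by
          rw [show -(1 + ε) + 1 = -ε by ring]
          simp
          field_simp
          ring
    · right
      refine ⟨by linarith, ?_⟩
      rw [Set.uIcc_of_le (by push_cast; linarith [Nat.cast_nonneg (α := ℝ) N])]
      simp
  have hs := summable_natCast_rpow_neg_one_add hε
  rw [hs.tsum_eq_zero_add, ((summable_nat_add_iff 1).mpr hs).tsum_eq_zero_add]
  have h2 : ∑' n : ℕ, ((n + 1 + 1 : ℕ) : ℝ) ^ (-(1 + ε)) ≤ 1 / ε := by
    refine Real.tsum_le_of_sum_range_le (fun n ↦ by positivity) fun N ↦ (key N).trans ?_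
    have : 0 ≤ ((N + 1 : ℕ) : ℝ) ^ (-ε) / ε := by positivity
    linarith
  have h0 : ((0 : ℕ) : ℝ) ^ (-(1 + ε)) = 0 := by
    rw [Nat.cast_zero, Real.zero_rpow (by linarith)]
  have h1 : 1 ≤ 1 / ε := by rw [le_div_iff₀ hε]; linarith
  have e : 2 / ε = 1 / ε + 1 / ε := by ring
  rw [h0, e]
  simp only [zero_add, Nat.cast_one, Real.one_rpow]
  linarith

namespace DirichletCharacter

variable {d : ℕ} [NeZero d]

lemma sum_range_add_level {χ : DirichletCharacter ℂ d} (hχ : χ ≠ 1) (N : ℕ) :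
    ∑ n ∈ Finset.range (N + d), χ n = ∑ n ∈ Finset.range N, χ n := by
  have h0 : ∑ n ∈ Finset.range d, χ (n : ZMod d) = 0 := by
    rw [← MulChar.sum_eq_zero_of_ne_one hχ]
    refine Finset.sum_bij (fun n _ ↦ (n : ZMod d)) (by simp) ?_ ?_ (by simp)
    · intro a ha b hb hab
      simp only [Finset.mem_range] at ha hb
      rwa [ZMod.natCast_eq_natCast_iff', Nat.mod_eq_of_lt ha, Nat.mod_eq_of_lt hb] at hab
    · intro b _
      exact ⟨b.val, by simpa using ZMod.val_lt b, by simp⟩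
  rw [add_comm, Finset.sum_range_add, h0, zero_add]
  simp

lemma norm_sum_range_le_level {χ : DirichletCharacter ℂ d} (hχ : χ ≠ 1) (N : ℕ) :
    ‖∑ n ∈ Finset.range N, χ n‖ ≤ d := by
  induction N using Nat.strong_induction_on with
  | _ N ih =>
    rcases lt_or_ge N d with h | h
    · refine (norm_sum_le_of_le _ fun n _ ↦ χ.norm_le_one _).trans ?_
      simpa using h.le
    · obtain ⟨m, rfl⟩ := Nat.exists_eq_add_of_le' h
      rw [sum_range_add_level hχ]
      exact ih m (by have := NeZero.pos d; omega)

omit [NeZero d] in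
lemma norm_sum_range_succ_le {χ : DirichletCharacter ℂ d} (hχ : χ ≠ 1) (n : ℕ) :
    ‖∑ m ∈ Finset.range (n + 1), χ m‖ ≤ n := by
  have h0 : χ ((0 : ℕ) : ZMod d) = 0 := by
    rw [Nat.cast_zero]
    exact χ.map_zero' fun hd ↦ hχ (level_one' χ hd)
  rw [Finset.sum_range_succ', h0, add_zero]
  refine (norm_sum_le_of_le _ fun n _ ↦ χ.norm_le_one _).trans ?_
  simp

end DirichletCharacter

lemma Complex.norm_natCast_cpow_neg_sub_succ_le {n : ℕ} (hn : 0 < n) {s : ℂ} (hs : 0 ≤ s.re) :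
    ‖(n : ℂ) ^ (-s) - ((n + 1 : ℕ) : ℂ) ^ (-s)‖ ≤ ‖s‖ * (n : ℝ) ^ (-(s.re + 1)) := by
  have hn' : (0 : ℝ) < n := by exact_mod_cast hn
  rcases eq_or_ne s 0 with rfl | hs0
  · simp
  have hd (t : ℝ) (ht : t ∈ Set.Icc (n : ℝ) (n + 1 : ℕ)) :
      HasDerivWithinAt (fun x : ℝ ↦ (x : ℂ) ^ (-s)) (-s * (t : ℂ) ^ (-s - 1))
        (Set.Icc (n : ℝ) (n + 1 : ℕ)) t := by
    have ht0 : (0 : ℝ) < t := hn'.trans_le ht.1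
    rw [← deriv_ofReal_cpow_const ht0.ne' (neg_ne_zero.mpr hs0)]
    exact (differentiableAt_id.ofReal_cpow_const ht0.ne'
      (neg_ne_zero.mpr hs0)).hasDerivAt.hasDerivWithinAt
  have h := norm_image_sub_le_of_norm_deriv_le_segment' (C := ‖s‖ * (n : ℝ) ^ (-(s.re + 1))) hd
    (fun t ht ↦ ?_) (n + 1 : ℕ) (by simp)
  · rw [norm_sub_rev]
    simpa using h
  · have ht0 : (0 : ℝ) < t := hn'.trans_le ht.1
    rw [norm_mul, norm_neg, Complex.norm_cpow_eq_rpow_re_of_pos ht0]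
    gcongr
    rw [show (-s - 1).re = -(s.re + 1) by simp; ring]
    exact Real.rpow_le_rpow_of_nonpos hn' ht.1 (by linarith)

namespace DirichletCharacter

variable {d : ℕ} [NeZero d]

/-- The general term of the Dirichlet series of `χ` after summation by parts. -/
noncomputable def abelTerm (χ : DirichletCharacter ℂ d) (n : ℕ) (s : ℂ) : ℂ :=
  (∑ m ∈ Finset.range (n + 1), χ m) * ((n : ℂ) ^ (-s) - ((n + 1 : ℕ) : ℂ) ^ (-s))

omit [NeZero d] in
lemma norm_abelTerm_le {χ : DirichletCharacter ℂ d} (hχ : χ ≠ 1) (n : ℕ) {s : ℂ}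
    (hs : 0 ≤ s.re) :
    ‖abelTerm χ n s‖ ≤ ‖∑ m ∈ Finset.range (n + 1), χ m‖ * (‖s‖ * (n : ℝ) ^ (-(1 + s.re))) := by
  rw [abelTerm, norm_mul]
  rcases n.eq_zero_or_pos with rfl | hn
  · have h := norm_sum_range_succ_le hχ 0
    rw [Nat.cast_zero, norm_le_zero_iff] at h
    simp only [h, norm_zero, zero_mul, le_refl]
  · rw [add_comm 1]
    gcongr
    exact Complex.norm_natCast_cpow_neg_sub_succ_le hn hs

lemma summable_abelTerm {χ : DirichletCharacter ℂ d} (hχ : χ ≠ 1) {s : ℂ} (hs : 0 < s.re) :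
    Summable fun n ↦ abelTerm χ n s := by
  refine .of_norm_bounded (((summable_natCast_rpow_neg_one_add hs).mul_left ‖s‖).mul_left (d : ℝ))
    fun n ↦ (norm_abelTerm_le hχ n hs.le).trans ?_
  gcongr
  exact norm_sum_range_le_level hχ _

lemma differentiableOn_tsum_abelTerm {χ : DirichletCharacter ℂ d} (hχ : χ ≠ 1) :
    DifferentiableOn ℂ (fun s ↦ ∑' n, abelTerm χ n s) {s | 0 < s.re} := by
  intro s₀ hs₀
  replace hs₀ : 0 < s₀.re := hs₀
  set U : Set ℂ := {s | s₀.re / 2 < s.re} ∩ Metric.ball 0 (‖s₀‖ + 1) with hU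
  have hUo : IsOpen U :=
    (Complex.continuous_re.isOpen_preimage _ isOpen_Ioi).inter Metric.isOpen_ball
  have hmem : s₀ ∈ U := ⟨by simp only [Set.mem_ofPred_eq]; linarith, by simp⟩
  have hd : DifferentiableOn ℂ (fun s ↦ ∑' n, abelTerm χ n s) U := by
    refine Complex.differentiableOn_tsum_of_summable_norm
      (u := fun n : ℕ ↦ (d : ℝ) * ((‖s₀‖ + 1) * (n : ℝ) ^ (-(1 + s₀.re / 2))))
      (((summable_natCast_rpow_neg_one_add (by linarith)).mul_left _).mul_left _) ?_ hUo ?_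
    · intro n s hs
      have hs' : s ≠ 0 := by
        rintro rfl
        have := hs.1
        simp only [Set.mem_ofPred_eq, Complex.zero_re] at this
        linarith
      have h (m : ℕ) : DifferentiableAt ℂ (fun s : ℂ ↦ (m : ℂ) ^ (-s)) s :=
        (hasDerivAt_neg s).differentiableAt.const_cpow (Or.inr (neg_ne_zero.mpr hs'))
      exact (((h n).sub (h (n + 1))).const_mul _).differentiableWithinAt
    · intro n s hs
      have h1 : s₀.re / 2 < s.re := hs.1
      have h2 : ‖s‖ < ‖s₀‖ + 1 := by simpa using hs.2
      refine (norm_abelTerm_le hχ n (by linarith)).trans ?_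
      rcases n.eq_zero_or_pos with rfl | hn
      · rw [Nat.cast_zero, Real.zero_rpow (by linarith), Real.zero_rpow (by linarith)]
        simp
      · gcongr
        · exact norm_sum_range_le_level hχ _
        · exact_mod_cast hn
  exact ((hd s₀ hmem).differentiableAt (hUo.mem_nhds hmem)).differentiableWithinAt

omit [NeZero d] in
lemma sum_range_mul_cpow_eq (χ : DirichletCharacter ℂ d) (s : ℂ) (N : ℕ) :
    ∑ n ∈ Finset.range N, χ n * (n : ℂ) ^ (-s) = ∑ n ∈ Finset.range N, abelTerm χ n s +
      (∑ n ∈ Finset.range N, χ n) * (N : ℂ) ^ (-s) := by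
  induction N with
  | zero => simp
  | succ N ih =>
    rw [Finset.sum_range_succ, ih, Finset.sum_range_succ _ N, abelTerm, Finset.sum_range_succ _ N]
    ring

lemma LSeries_eq_tsum_abelTerm {χ : DirichletCharacter ℂ d} (hχ : χ ≠ 1) {s : ℂ}
    (hs : 1 < s.re) : LSeries (χ ·) s = ∑' n, abelTerm χ n s := by
  have h0 : s ≠ 0 := by
    rintro rfl
    simp at hs
    linarith
  have hterm : (fun n : ℕ ↦ χ n * (n : ℂ) ^ (-s)) = LSeries.term (χ ·) s := by
    ext n
    rcases eq_or_ne n 0 with rfl | hn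
    · simp [h0]
    · rw [LSeries.term_of_ne_zero hn, Complex.cpow_neg, div_eq_mul_inv]
  have h1 : Filter.Tendsto (fun N ↦ ∑ n ∈ Finset.range N, χ n * (n : ℂ) ^ (-s)) Filter.atTop
      (nhds (LSeries (χ ·) s)) := by
    have hsum := LSeriesSummable_of_one_lt_re χ hs
    rw [LSeriesSummable, ← hterm] at hsum
    rw [LSeries, ← hterm]
    exact hsum.hasSum.tendsto_sum_nat
  have h2 : Filter.Tendsto (fun N ↦ ∑ n ∈ Finset.range N, χ n * (n : ℂ) ^ (-s)) Filter.atTop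
      (nhds (∑' n, abelTerm χ n s + 0)) := by
    simp_rw [sum_range_mul_cpow_eq]
    refine (summable_abelTerm hχ (by linarith)).hasSum.tendsto_sum_nat.add ?_
    refine squeeze_zero_norm (a := fun N : ℕ ↦ (d : ℝ) * (N : ℝ) ^ (-s.re)) (fun N ↦ ?_) ?_
    · rw [norm_mul]
      gcongr
      · exact norm_sum_range_le_level hχ _
      · rcases N.eq_zero_or_pos with rfl | hN
        · simp [h0]
          positivity
        · rw [Complex.norm_natCast_cpow_of_pos hN]
          simp
    · have := (tendsto_rpow_neg_atTop (y := s.re) (by linarith)).comp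
        (tendsto_natCast_atTop_atTop (R := ℝ))
      simpa using this.const_mul (d : ℝ)
  simpa using tendsto_nhds_unique h1 h2

lemma LFunction_eq_tsum_abelTerm {χ : DirichletCharacter ℂ d} (hχ : χ ≠ 1) {s : ℂ}
    (hs : 0 < s.re) : LFunction χ s = ∑' n, abelTerm χ n s := by
  have hopen : IsOpen {s : ℂ | 0 < s.re} := Complex.continuous_re.isOpen_preimage _ isOpen_Ioi
  have h1 : AnalyticOnNhd ℂ (LFunction χ) {s : ℂ | 0 < s.re} :=
    (differentiable_LFunction hχ).differentiableOn.analyticOnNhd hopen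
  have h2 := (differentiableOn_tsum_abelTerm hχ).analyticOnNhd hopen
  refine h1.eqOn_of_preconnected_of_eventuallyEq h2
    (convex_halfSpace_re_gt 0).isPreconnected (z₀ := 2) (by simp) ?_ hs
  have : {s : ℂ | 1 < s.re} ∈ nhds (2 : ℂ) :=
    (Complex.continuous_re.isOpen_preimage _ isOpen_Ioi).mem_nhds (by simp)
  filter_upwards [this] with z hz
  rw [LFunction_eq_LSeries χ hz, LSeries_eq_tsum_abelTerm hχ hz]

lemma norm_LFunction_le {χ : DirichletCharacter ℂ d} (hχ : χ ≠ 1) {l : ℝ} (hl : 2 ≤ l)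
    (hd : d ≤ Real.exp l) {s : ℂ} (hs : ‖s - 1‖ ≤ 1 / l) : ‖LFunction χ s‖ ≤ 32 * l := by
  have hl0 : 0 < l := by linarith
  have hl1 : 1 / l ≤ 1 / 2 := one_div_le_one_div_of_le two_pos hl
  have hre : 1 - 1 / l ≤ s.re := by
    have := (abs_le.mp ((Complex.abs_re_le_norm (s - 1)).trans hs)).1
    simp at this ⊢
    linarith
  have hns : ‖s‖ ≤ 2 := by
    calc ‖s‖ = ‖(s - 1) + 1‖ := by ring_nf
      _ ≤ ‖s - 1‖ + ‖(1 : ℂ)‖ := norm_add_le _ _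
      _ ≤ 2 := by rw [norm_one]; linarith
  have hd0 : (0 : ℝ) < d := by exact_mod_cast NeZero.pos d
  have hβ : (d : ℝ) ^ (2 / l) ≤ 8 := by
    calc (d : ℝ) ^ (2 / l) ≤ (Real.exp l) ^ (2 / l) := by gcongr
      _ = Real.exp 1 ^ 2 := by
        rw [← Real.exp_mul, ← Real.exp_nat_mul]
        congr 1
        field_simp
        norm_num
      _ ≤ 8 := by nlinarith [Real.exp_one_lt_d9, Real.exp_pos 1]
  have hterm (n : ℕ) : ‖abelTerm χ n s‖ ≤ 16 * (n : ℝ) ^ (-(1 + 1 / l)) := by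
    refine (norm_abelTerm_le hχ n (by linarith)).trans ?_
    rcases n.eq_zero_or_pos with rfl | hn
    · rw [Nat.cast_zero, Real.zero_rpow (by linarith)]
      have : 0 < 1 / l := by positivity
      rw [Real.zero_rpow (by linarith)]
      simp
    have hn0 : (0 : ℝ) < n := by exact_mod_cast hn
    have hn1 : (1 : ℝ) ≤ n := by exact_mod_cast hn
    set S := ‖∑ m ∈ Finset.range (n + 1), χ m‖
    have hS0 : 0 ≤ S := norm_nonneg _
    have hS : S ≤ (n : ℝ) ^ (1 - 2 / l) * (d : ℝ) ^ (2 / l) := by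
      have h2l : 2 / l ≤ 1 := by rw [div_le_one hl0]; exact hl
      calc S = S ^ (1 - 2 / l) * S ^ (2 / l) := by
            rw [← Real.rpow_add_of_nonneg hS0 (by linarith) (by positivity)]
            simp
        _ ≤ _ := by
            gcongr
            · exact norm_sum_range_succ_le hχ n
            · exact norm_sum_range_le_level hχ _
    calc S * (‖s‖ * (n : ℝ) ^ (-(1 + s.re)))
        ≤ ((n : ℝ) ^ (1 - 2 / l) * 8) * (2 * (n : ℝ) ^ (-(1 + (1 - 1 / l)))) := by
          gcongr
          exact hS.trans (by gcongr)
      _ = 16 * ((n : ℝ) ^ (1 - 2 / l) * (n : ℝ) ^ (-(1 + (1 - 1 / l)))) := by ring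
      _ = 16 * (n : ℝ) ^ (-(1 + 1 / l)) := by
          rw [← Real.rpow_add hn0]
          congr 2
          ring
  rw [LFunction_eq_tsum_abelTerm hχ (by linarith)]
  have hpos : 0 < 1 / l := by positivity
  have hsum := summable_natCast_rpow_neg_one_add hpos
  calc ‖∑' n, abelTerm χ n s‖ ≤ ∑' n : ℕ, 16 * (n : ℝ) ^ (-(1 + 1 / l)) :=
        tsum_of_norm_bounded (hsum.mul_left 16).hasSum hterm
    _ = 16 * ∑' n : ℕ, (n : ℝ) ^ (-(1 + 1 / l)) := tsum_mul_left
    _ ≤ 16 * (2 / (1 / l)) := by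
        gcongr
        exact tsum_natCast_rpow_neg_one_add_le hpos (by linarith)
    _ = 32 * l := by field_simp; norm_num

end DirichletCharacter

namespace DirichletCharacter

variable {d : ℕ} [NeZero d]

lemma norm_LFunctionTrivChar_one_add_le {η : ℝ} (hη : 0 < η) (hη1 : η ≤ 1) :
    ‖LFunctionTrivChar d (1 + η)‖ ≤ 2 / η := by
  have hre : 1 < (1 + η : ℂ).re := by simpa using hη
  rw [LFunctionTrivChar, LFunction_eq_LSeries _ hre]
  refine le_trans (tsum_of_norm_bounded (summable_natCast_rpow_neg_one_add hη).hasSum fun n ↦ ?_)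
    (tsum_natCast_rpow_neg_one_add_le hη hη1)
  rcases n.eq_zero_or_pos with rfl | hn
  · simp only [LSeries.term_zero, norm_zero]
    positivity
  · rw [LSeries.term_of_ne_zero hn.ne', norm_div, Complex.norm_natCast_cpow_of_pos hn,
      Real.rpow_neg (by positivity), div_eq_mul_inv]
    simp only [Complex.add_re, Complex.one_re, Complex.ofReal_re]
    exact mul_le_of_le_one_left (by positivity) (norm_le_one _ _)

lemma norm_deriv_LFunction_le {χ : DirichletCharacter ℂ d} (hχ : χ ≠ 1) {l : ℝ} (hl : 2 ≤ l)
    (hd : d ≤ Real.exp l) {s : ℂ} (hs : ‖s - 1‖ ≤ 1 / (2 * l)) :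
    ‖deriv (LFunction χ) s‖ ≤ 64 * l ^ 2 := by
  have hl0 : 0 < l := by linarith
  have h := Complex.norm_deriv_le_of_forall_mem_sphere_norm_le (c := s) (R := 1 / (2 * l))
    (C := 32 * l) (f := LFunction χ) (by positivity)
    (differentiable_LFunction hχ).diffContOnCl fun z hz ↦ by
      refine norm_LFunction_le hχ hl hd ?_
      rw [mem_sphere_iff_norm] at hz
      calc ‖z - 1‖ = ‖(z - s) + (s - 1)‖ := by ring_nf
        _ ≤ ‖z - s‖ + ‖s - 1‖ := norm_add_le _ _
        _ ≤ 1 / (2 * l) + 1 / (2 * l) := by rw [hz]; gcongr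
        _ = 1 / l := by field_simp; norm_num
  refine h.trans (le_of_eq ?_)
  field_simp
  norm_num

lemma le_norm_LFunction_one_add {χ : DirichletCharacter ℂ d} (hχ : χ ^ 2 ≠ 1) {l η : ℝ}
    (hl : 2 ≤ l) (hd : d ≤ Real.exp l) (hη0 : 0 < η) (hη : 2 ^ 40 * η * l ^ 9 = 1)
    (hηl : η ≤ 1 / l) : 256 * η * l ^ 2 ≤ ‖LFunction χ (1 + η)‖ := by
  have hl0 : 0 < l := by linarith
  have hη1 : η ≤ 1 := hηl.trans (by rw [div_le_one hl0]; linarith)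
  by_contra! hlt
  have h := norm_LFunction_product_ge_one χ hη0 0
  simp only [Complex.ofReal_zero, mul_zero, add_zero, norm_mul, norm_pow] at h
  have h1 := norm_LFunctionTrivChar_one_add_le (d := d) hη0 hη1
  have h2 : ‖LFunction (χ ^ 2) (1 + η)‖ ≤ 32 * l := by
    refine norm_LFunction_le hχ hl hd ?_
    rw [add_sub_cancel_left, Complex.norm_real, Real.norm_of_nonneg hη0.le]
    exact hηl
  have h3 : ‖LFunctionTrivChar d (1 + η)‖ ^ 3 * ‖LFunction χ (1 + η)‖ ^ 4 *
      ‖LFunction (χ ^ 2) (1 + η)‖ ≤ (2 / η) ^ 3 * ‖LFunction χ (1 + η)‖ ^ 4 * (32 * l) := by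
    gcongr
  have h4 : (2 / η) ^ 3 * ‖LFunction χ (1 + η)‖ ^ 4 * (32 * l) <
      (2 / η) ^ 3 * (256 * η * l ^ 2) ^ 4 * (32 * l) := by
    gcongr
  have h5 : (2 / η) ^ 3 * (256 * η * l ^ 2) ^ 4 * (32 * l) = 2 ^ 40 * η * l ^ 9 := by
    field_simp
    norm_num
  linarith

lemma LFunction_ne_zero_and_norm_logDeriv_le {χ : DirichletCharacter ℂ d} (hχ : χ ^ 2 ≠ 1)
    {l η : ℝ} (hl : 2 ≤ l) (hd : d ≤ Real.exp l) (hη0 : 0 < η) (hη : 2 ^ 40 * η * l ^ 9 = 1)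
    {s : ℂ} (hs : s ∈ Metric.closedBall (1 + η : ℂ) (2 * η)) :
    LFunction χ s ≠ 0 ∧ ‖deriv (LFunction χ) s / LFunction χ s‖ ≤ 1 / (2 * η) := by
  have hl0 : 0 < l := by linarith
  have hχ1 : χ ≠ 1 := by
    rintro rfl
    simp at hχ
  have hηl : 3 * η ≤ 1 / (2 * l) := by
    rw [le_div_iff₀ (by positivity)]
    have h8 : (1 : ℝ) ≤ l ^ 8 := one_le_pow₀ (by linarith)
    have : η * l * 1 ≤ η * l * l ^ 8 := by gcongr
    nlinarith
  have hle : η ≤ 1 / l := by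
    have : 1 / (2 * l) ≤ 1 / l := by gcongr; linarith
    linarith
  have hL0 := le_norm_LFunction_one_add hχ hl hd hη0 hη hle
  have hball : ∀ z ∈ Metric.closedBall (1 + η : ℂ) (2 * η),
      ‖deriv (LFunction χ) z‖ ≤ 64 * l ^ 2 := by
    intro z hz
    refine norm_deriv_LFunction_le hχ1 hl hd ?_
    rw [mem_closedBall_iff_norm] at hz
    calc ‖z - 1‖ = ‖(z - (1 + η)) + η‖ := by ring_nf
      _ ≤ ‖z - (1 + η)‖ + ‖(η : ℂ)‖ := norm_add_le _ _
      _ ≤ 2 * η + η := by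
        gcongr
        rw [Complex.norm_real, Real.norm_of_nonneg hη0.le]
      _ ≤ 1 / (2 * l) := by linarith
  have hdiff : ‖LFunction χ s - LFunction χ (1 + η)‖ ≤ 128 * η * l ^ 2 := by
    have h := (convex_closedBall (1 + η : ℂ) (2 * η)).norm_image_sub_le_of_norm_deriv_le
      (fun z _ ↦ (differentiable_LFunction hχ1).differentiableAt) hball
      (Metric.mem_closedBall_self (by positivity)) hs
    refine h.trans ?_
    rw [mem_closedBall_iff_norm] at hs
    calc _ ≤ 64 * l ^ 2 * (2 * η) := by gcongr
      _ = _ := by ring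
  have hLs : 128 * η * l ^ 2 ≤ ‖LFunction χ s‖ := by
    have := norm_sub_norm_le (LFunction χ (1 + η)) (LFunction χ s)
    rw [norm_sub_rev] at this
    linarith
  have hpos : 0 < 128 * η * l ^ 2 := by positivity
  refine ⟨norm_pos_iff.mp (hpos.trans_le hLs), ?_⟩
  rw [norm_div]
  calc _ ≤ 64 * l ^ 2 / (128 * η * l ^ 2) := by
        gcongr
        exact hball s hs
    _ = _ := by field_simp; norm_num

lemma norm_iteratedDeriv_logDeriv_le {χ : DirichletCharacter ℂ d} (hχ : χ ^ 2 ≠ 1)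
    {l η : ℝ} (hl : 2 ≤ l) (hd : d ≤ Real.exp l) (hη0 : 0 < η) (hη : 2 ^ 40 * η * l ^ 9 = 1)
    (j : ℕ) :
    ‖iteratedDeriv j (fun s ↦ deriv (LFunction χ) s / LFunction χ s) (1 + η)‖ ≤
      j.factorial / (2 * η) ^ (j + 1) := by
  have hχ1 : χ ≠ 1 := by
    rintro rfl
    simp at hχ
  have hdiff := differentiable_LFunction hχ1
  have h := Complex.norm_iteratedDeriv_le_of_forall_mem_sphere_norm_le (c := (1 + η : ℂ))
    (R := 2 * η) (C := 1 / (2 * η)) (f := fun s ↦ deriv (LFunction χ) s / LFunction χ s) j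
    (by positivity) ?_ fun z hz ↦
      (LFunction_ne_zero_and_norm_logDeriv_le hχ hl hd hη0 hη
        (Metric.sphere_subset_closedBall hz)).2
  · refine h.trans (le_of_eq ?_)
    rw [pow_succ]
    field_simp
  · refine DifferentiableOn.diffContOnCl fun z hz ↦ ?_
    rw [closure_ball _ (by positivity)] at hz
    have hz0 := (LFunction_ne_zero_and_norm_logDeriv_le hχ hl hd hη0 hη hz).1
    exact ((hdiff.deriv z).div hdiff.differentiableAt hz0).differentiableWithinAt

end DirichletCharacter

open ArithmeticFunction

/-- The weights `Λ(n) (log n)^j n^{-σ}`. -/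
noncomputable def logWeight (j : ℕ) (σ : ℝ) (n : ℕ) : ℝ :=
  vonMangoldt n * Real.log n ^ j * (n : ℝ) ^ (-σ)

lemma logWeight_nonneg (j : ℕ) (σ : ℝ) (n : ℕ) : 0 ≤ logWeight j σ n := by
  have := ArithmeticFunction.vonMangoldt_nonneg (n := n)
  have := Real.log_natCast_nonneg n
  rw [logWeight]
  positivity

lemma logMul_iterate_apply (f : ℕ → ℂ) (j n : ℕ) :
    (LSeries.logMul^[j] f) n = Complex.log n ^ j * f n := by
  induction j with
  | zero => simp
  | succ j ih => rw [Function.iterate_succ_apply', LSeries.logMul, ih]; ring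

lemma term_logMul_iterate (g : ℕ → ℂ) (j : ℕ) (σ : ℝ) (n : ℕ) :
    LSeries.term (LSeries.logMul^[j] fun n ↦ g n * vonMangoldt n) σ n =
      g n * (logWeight j σ n : ℂ) := by
  rcases n.eq_zero_or_pos with rfl | hn
  · simp [logWeight]
  · rw [LSeries.term_of_ne_zero hn.ne', logMul_iterate_apply, logWeight]
    push_cast
    rw [Complex.ofReal_cpow (by positivity), ← Complex.natCast_log]
    push_cast
    rw [Complex.cpow_neg]
    ring

lemma abscissaOfAbsConv_mul_vonMangoldt_le {g : ℕ → ℂ} (hg : ∀ n, ‖g n‖ ≤ 1) :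
    LSeries.abscissaOfAbsConv (fun n ↦ g n * vonMangoldt n) ≤ 1 := by
  refine LSeries.abscissaOfAbsConv_le_of_forall_lt_LSeriesSummable fun y hy ↦ ?_
  refine (LSeriesSummable_vonMangoldt (s := y) (by simpa using hy)).norm.of_norm_bounded fun n ↦ ?_
  refine LSeries.norm_term_le _ ?_
  rw [norm_mul]
  exact mul_le_of_le_one_left (norm_nonneg _) (hg n)

lemma summable_mul_logWeight {g : ℕ → ℂ} (hg : ∀ n, ‖g n‖ ≤ 1) (j : ℕ) {σ : ℝ} (hσ : 1 < σ) :
    Summable fun n ↦ g n * (logWeight j σ n : ℂ) := by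
  simp_rw [← term_logMul_iterate]
  refine LSeriesSummable_of_abscissaOfAbsConv_lt_re ?_
  rw [LSeries.absicssaOfAbsConv_logPowMul]
  exact (abscissaOfAbsConv_mul_vonMangoldt_le hg).trans_lt (by exact_mod_cast hσ)

lemma iteratedDeriv_LSeries_mul_vonMangoldt {g : ℕ → ℂ} (hg : ∀ n, ‖g n‖ ≤ 1) (j : ℕ) {σ : ℝ}
    (hσ : 1 < σ) :
    iteratedDeriv j (LSeries fun n ↦ g n * vonMangoldt n) σ =
      (-1) ^ j * ∑' n, g n * (logWeight j σ n : ℂ) := by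
  rw [LSeries_iteratedDeriv j
    ((abscissaOfAbsConv_mul_vonMangoldt_le hg).trans_lt (by exact_mod_cast hσ)), LSeries]
  simp_rw [term_logMul_iterate]

lemma summable_logWeight (j : ℕ) {σ : ℝ} (hσ : 1 < σ) : Summable (logWeight j σ) := by
  have h := summable_mul_logWeight (g := fun _ ↦ 1) (by simp) j hσ
  simp only [one_mul] at h
  exact_mod_cast h

open Complex in
lemma DirichletCharacter.norm_tsum_mul_logWeight_le {d : ℕ} [NeZero d]
    {χ : DirichletCharacter ℂ d} (hχ : χ ^ 2 ≠ 1) {l η : ℝ} (hl : 2 ≤ l) (hd : d ≤ Real.exp l)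
    (hη0 : 0 < η) (hη : 2 ^ 40 * η * l ^ 9 = 1) (j : ℕ) :
    ‖∑' n : ℕ, χ n * (logWeight j (1 + η) n : ℂ)‖ ≤ j.factorial / (2 * η) ^ (j + 1) := by
  have h := iteratedDeriv_LSeries_mul_vonMangoldt (g := fun n : ℕ ↦ χ n)
    (fun n ↦ χ.norm_le_one n) j (show 1 < 1 + η by linarith)
  have hev : (LSeries fun n ↦ χ n * vonMangoldt n) =ᶠ[nhds ((1 + η : ℝ) : ℂ)]
      fun s ↦ -(deriv (LFunction χ) s / LFunction χ s) := by
    have : {s : ℂ | 1 < s.re} ∈ nhds ((1 + η : ℝ) : ℂ) :=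
      (isOpen_lt continuous_const Complex.continuous_re).mem_nhds (by simp [hη0])
    filter_upwards [this] with s hs
    rw [deriv_LFunction_eq_deriv_LSeries _ hs, LFunction_eq_LSeries _ hs, ← neg_div,
      ← LSeries_twist_vonMangoldt_eq _ hs]
    rfl
  rw [hev.iteratedDeriv_eq, iteratedDeriv_fun_neg] at h
  have h2 := congrArg norm h
  rw [norm_neg, norm_mul, norm_pow, norm_neg, norm_one, one_pow, one_mul] at h2
  rw [← h2]
  have := norm_iteratedDeriv_logDeriv_le hχ hl hd hη0 hη j
  push_cast
  exact this

open DirichletCharacter ArithmeticFunction.vonMangoldt in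
lemma analyticAt_LFunctionResidueClassAux_one {M : ℕ} [NeZero M] (a : ZMod M) :
    AnalyticAt ℂ (LFunctionResidueClassAux a) 1 := by
  classical
  refine analyticAt_const.mul (AnalyticAt.fun_sub ?_ ?_)
  · have := (differentiable_LFunctionTrivChar₁ M).analyticAt 1
    exact this.deriv.neg.fun_div this (LFunctionTrivChar₁_apply_one_ne_zero M)
  · refine Finset.analyticAt_fun_sum _ fun χ hχ ↦ ?_
    have hχ : χ ≠ 1 := by simpa using hχ
    have := (differentiable_LFunction hχ).analyticAt 1
    exact (analyticAt_const.fun_mul this.deriv).fun_div this (LFunction_apply_one_ne_zero hχ)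

lemma iteratedDeriv_inv_sub_one (j : ℕ) (s : ℂ) :
    iteratedDeriv j (fun s : ℂ ↦ (s - 1)⁻¹) s = (-1) ^ j * (j.factorial / (s - 1) ^ (j + 1)) := by
  have h := congrFun (iter_deriv_inv_linear_sub j (1 : ℂ) 1) s
  simp only [one_mul, one_pow, mul_one] at h
  rw [iteratedDeriv_eq_iterate, h, show (-1 - j : ℤ) = -((j + 1 : ℕ) : ℤ) by push_cast; ring,
    zpow_neg, zpow_natCast]
  ring

open DirichletCharacter ArithmeticFunction.vonMangoldt in
lemma exists_le_tsum_logWeight_residueClass (M : ℕ) [NeZero M] :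
    ∃ c > 0, ∃ η₀ > 0, ∀ η : ℝ, 0 < η → η ≤ η₀ → ∀ j : ℕ,
      c * (j.factorial / η ^ (j + 1)) ≤
        ∑' n : ℕ, if (n : ZMod M) = 1 then logWeight j (1 + η) n else 0 := by
  obtain ⟨h, hh⟩ : ∃ h, h = LFunctionResidueClassAux (1 : ZMod M) := ⟨_, rfl⟩
  have han : AnalyticAt ℂ h 1 := hh ▸ analyticAt_LFunctionResidueClassAux_one 1
  have hbd : ∀ᶠ s in nhds (1 : ℂ), ‖h s‖ < ‖h 1‖ + 1 :=
    han.continuousAt.norm.eventually_lt_const (lt_add_one _)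
  obtain ⟨ρ, hρ, hball⟩ := Metric.eventually_nhds_iff_ball.mp (han.eventually_analyticAt.and hbd)
  set K := ‖h 1‖ + 1 with hK
  have hK0 : 0 < K := by positivity
  have hφ : 0 < (M.totient : ℝ) := mod_cast M.totient_pos.mpr M.pos_of_neZero
  refine ⟨1 / (2 * M.totient), by positivity, min (ρ / 4) (1 / (2 * M.totient * K)), by positivity,
    fun η hη0 hη j ↦ ?_⟩
  have hη1 := hη.trans (min_le_left _ _)
  have hη2 := hη.trans (min_le_right _ _)
  set w : ℂ := ((1 + η : ℝ) : ℂ) with hw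
  have hw1 : w - 1 = η := by rw [hw]; push_cast; ring
  have hsub : Metric.closedBall w η ⊆ Metric.ball 1 ρ := by
    refine Metric.closedBall_subset_ball' ?_
    rw [Complex.dist_eq, hw1, Complex.norm_real, Real.norm_of_nonneg hη0.le]
    linarith
  have hcauchy : ‖iteratedDeriv j h w‖ ≤ j.factorial * K / η ^ j := by
    refine Complex.norm_iteratedDeriv_le_of_forall_mem_sphere_norm_le j hη0 ?_ fun z hz ↦
      (hball z (hsub (Metric.sphere_subset_closedBall hz))).2.le
    refine DifferentiableOn.diffContOnCl_ball (U := Metric.ball 1 ρ) (fun z hz ↦ ?_) hsub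
    exact (hball z hz).1.differentiableAt.differentiableWithinAt
  have hev : h =ᶠ[nhds w] fun s ↦ (LSeries fun n : ℕ ↦
      (if (n : ZMod M) = 1 then (1 : ℂ) else 0) * vonMangoldt n) s
        - (M.totient : ℂ)⁻¹ * (s - 1)⁻¹ := by
    have : {s : ℂ | 1 < s.re} ∈ nhds w :=
      (isOpen_lt continuous_const Complex.continuous_re).mem_nhds (by simp [hw, hη0])
    filter_upwards [this] with s hs
    rw [hh, eqOn_LFunctionResidueClassAux isUnit_one hs]
    beta_reduce
    rw [div_eq_mul_inv]
    congr 2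
    ext n
    by_cases hn : (n : ZMod M) = 1 <;> simp [residueClass, hn]
  have hg : ∀ n : ℕ, ‖(if (n : ZMod M) = 1 then (1 : ℂ) else 0)‖ ≤ 1 := by
    intro n; split_ifs <;> simp
  have hσ : (1 : ℝ) < 1 + η := by linarith
  have hw0 : w - 1 ≠ 0 := by rw [hw1]; exact_mod_cast hη0.ne'
  have hA : AnalyticAt ℂ (LSeries fun n : ℕ ↦
      (if (n : ZMod M) = 1 then (1 : ℂ) else 0) * vonMangoldt n) w :=
    LSeries_analyticOnNhd _ _
      ((abscissaOfAbsConv_mul_vonMangoldt_le hg).trans_lt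
        (by rw [hw, Complex.ofReal_re]; exact_mod_cast hσ))
  have hB : AnalyticAt ℂ (fun s : ℂ ↦ (M.totient : ℂ)⁻¹ * (s - 1)⁻¹) w :=
    analyticAt_const.fun_mul ((analyticAt_id.fun_sub analyticAt_const).fun_inv hw0)
  have hD := hev.iteratedDeriv_eq j
  rw [iteratedDeriv_fun_sub hA.contDiffAt hB.contDiffAt, iteratedDeriv_const_mul_field,
    iteratedDeriv_inv_sub_one, hw1, iteratedDeriv_LSeries_mul_vonMangoldt hg j hσ] at hD
  set S : ℝ := ∑' n : ℕ, if (n : ZMod M) = 1 then logWeight j (1 + η) n else 0 with hS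
  have hSC : (∑' n : ℕ, (if (n : ZMod M) = 1 then (1 : ℂ) else 0) * (logWeight j (1 + η) n : ℂ))
      = (S : ℂ) := by
    rw [hS, Complex.ofReal_tsum]
    refine tsum_congr fun n ↦ ?_
    split_ifs <;> simp
  rw [hSC] at hD
  have hnorm : ‖iteratedDeriv j h w‖ = |S - (M.totient : ℝ)⁻¹ * (j.factorial / η ^ (j + 1))| := by
    rw [hD, ← Real.norm_eq_abs, ← Complex.norm_real]
    push_cast
    rw [← one_mul ‖(S : ℂ) - _‖, ← one_pow (M := ℝ) j, ← norm_one (α := ℂ), ← norm_neg (1 : ℂ),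
      ← norm_pow, ← norm_mul]
    congr 1
    ring
  rw [hnorm] at hcauchy
  have h1 := (abs_le.mp hcauchy).1
  have h2 : j.factorial * K / η ^ j ≤ 1 / (2 * M.totient) * (j.factorial / η ^ (j + 1)) := by
    have : K ≤ 1 / (2 * M.totient) / η := by
      rw [le_div_iff₀ hη0]
      rw [le_div_iff₀ (by positivity)] at hη2 ⊢
      linarith
    calc j.factorial * K / η ^ j ≤ j.factorial * (1 / (2 * M.totient) / η) / η ^ j := by gcongr
      _ = _ := by rw [pow_succ]; field_simp
  have h3 : (M.totient : ℝ)⁻¹ * (j.factorial / η ^ (j + 1)) =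
    2 * (1 / (2 * M.totient) * (j.factorial / η ^ (j + 1))) := by field_simp
  linarith

namespace DirichletCharacter

open Finset in
lemma exists_sum_quadratic_eq {d : ℕ} [NeZero d] [DecidableEq (DirichletCharacter ℂ d)]
    (a : ZMod d) :
    ∃ r : ℝ, ∑ χ : DirichletCharacter ℂ d with χ ^ 2 = 1, χ a = r ∧ 0 ≤ r ∧
      ((∀ χ : DirichletCharacter ℂ d, χ ^ 2 = 1 → χ a = 1) → 1 ≤ r) := by
  by_cases h : ∀ χ : DirichletCharacter ℂ d, χ ^ 2 = 1 → χ a = 1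
  · refine ⟨#{χ : DirichletCharacter ℂ d | χ ^ 2 = 1}, ?_, by positivity, fun _ ↦ ?_⟩
    · rw [sum_congr rfl fun χ hχ ↦ h χ (by simpa using hχ)]
      simp
    · have : 0 < #{χ : DirichletCharacter ℂ d | χ ^ 2 = 1} := card_pos.mpr ⟨1, by simp⟩
      exact_mod_cast this
  · refine ⟨0, ?_, le_rfl, fun h' ↦ absurd h' h⟩
    push Not at h
    obtain ⟨χ₀, h₀, h₁⟩ := h
    have : χ₀ a * ∑ χ : DirichletCharacter ℂ d with χ ^ 2 = 1, χ a =
        ∑ χ : DirichletCharacter ℂ d with χ ^ 2 = 1, χ a := by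
      rw [mul_sum]
      refine sum_bij' (fun χ _ ↦ χ₀ * χ) (fun χ _ ↦ χ₀ * χ) ?_ ?_ ?_ ?_ ?_ <;>
        simp only [mem_filter, mem_univ, true_and, mul_pow, h₀, one_mul] <;> intro χ hχ
      · exact hχ
      · exact hχ
      · rw [← mul_assoc, ← sq, h₀, one_mul]
      · rw [← mul_assoc, ← sq, h₀, one_mul]
      · exact (MulChar.mul_apply _ _ _).symm
    have h2 : (χ₀ a - 1) * ∑ χ : DirichletCharacter ℂ d with χ ^ 2 = 1, χ a = 0 := by
      rw [sub_mul, this, one_mul, sub_self]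
    simpa [sub_eq_zero, h₁] using h2

lemma apply_eq_one_of_sq_eq_one {d M B n : ℕ} (hM : _root_.Odd M) (hd : d ∣ M ^ B)
    (hn : (n : ZMod M) = 1) {χ : DirichletCharacter ℂ d} (hχ : χ ^ 2 = 1) :
    χ (n : ZMod d) = 1 := by
  have h1 : ((M : ℕ) : ℤ) ∣ (n : ℤ) - 1 := by
    rw [← ZMod.intCast_eq_intCast_iff_dvd_sub]
    simp [hn]
  have h2 : (d : ℤ) ∣ (n : ℤ) ^ M ^ B - 1 := by
    have := dvd_sub_pow_of_dvd_sub (R := ℤ) (p := M) (a := n) (b := 1) (by exact_mod_cast h1) B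
    rw [one_pow] at this
    refine dvd_trans ?_ this
    exact_mod_cast hd.trans (pow_dvd_pow _ (Nat.le_succ B))
  have h3 : (n : ZMod d) ^ M ^ B = 1 := by
    have := (ZMod.intCast_eq_intCast_iff_dvd_sub 1 ((n : ℤ) ^ M ^ B) d).mpr h2
    push_cast at this
    exact this.symm
  have hodd : _root_.Odd (M ^ B) := hM.pow
  have hu : IsUnit (n : ZMod d) := by
    refine IsUnit.of_pow_eq_one h3 ?_
    exact hodd.pos.ne'
  have h4 : χ (n : ZMod d) ^ 2 = 1 := by
    rw [← MulChar.pow_apply' _ two_ne_zero, hχ, MulChar.one_apply hu]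
  have h5 : χ (n : ZMod d) ^ M ^ B = 1 := by rw [← map_pow, h3, map_one]
  obtain ⟨k, hk⟩ := hodd
  rwa [hk, pow_succ, pow_mul, h4, one_pow, one_mul] at h5

open Finset in
lemma tsum_logWeight_residueClass_le {d M B : ℕ} [NeZero d] (hM : _root_.Odd M) (hd : d ∣ M ^ B)
    {l η : ℝ} (hl : 2 ≤ l) (hdl : d ≤ Real.exp l)
    (hη0 : 0 < η) (hη : 2 ^ 40 * η * l ^ 9 = 1) (j : ℕ) :
    (∑' n : ℕ, if (n : ZMod M) = 1 then logWeight j (1 + η) n else 0) ≤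
      d.totient * (∑' n : ℕ, if (n : ZMod d) = 1 then logWeight j (1 + η) n else 0) +
        d.totient * (j.factorial / (2 * η) ^ (j + 1)) := by
  classical
  have hσ : 1 < 1 + η := by linarith
  set w := logWeight j (1 + η) with hw
  have hw0 : ∀ n, 0 ≤ w n := logWeight_nonneg _ _
  have hws : Summable w := summable_logWeight j hσ
  choose r hr hr0 hr1 using fun n : ℕ ↦ exists_sum_quadratic_eq (d := d) n
  have hsum (χ : DirichletCharacter ℂ d) : Summable fun n : ℕ ↦ χ n * (w n : ℂ) :=
    summable_mul_logWeight (fun n ↦ χ.norm_le_one n) j hσ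
  have hrs : Summable fun n ↦ r n * w n := by
    have : Summable fun n : ℕ ↦ ∑ χ : DirichletCharacter ℂ d with χ ^ 2 = 1, χ n * (w n : ℂ) :=
      summable_sum fun χ _ ↦ hsum χ
    simp_rw [← sum_mul, hr] at this
    exact_mod_cast this
  have h1 : (∑' n : ℕ, if (n : ZMod M) = 1 then w n else 0) ≤ ∑' n, r n * w n := by
    refine Summable.tsum_le_tsum (fun n ↦ ?_) ?_ hrs
    · split_ifs with h
      · exact le_mul_of_one_le_left (hw0 n)
          (hr1 n fun χ hχ ↦ apply_eq_one_of_sq_eq_one hM hd h hχ)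
      · exact mul_nonneg (hr0 n) (hw0 n)
    · refine hws.of_nonneg_of_le (fun n ↦ ?_) fun n ↦ ?_ <;> split_ifs <;> simp [hw0]
  have h2 : ((∑' n, r n * w n : ℝ) : ℂ) =
      ∑ χ : DirichletCharacter ℂ d with χ ^ 2 = 1, ∑' n : ℕ, χ n * (w n : ℂ) := by
    rw [← Summable.tsum_finsetSum fun χ _ ↦ hsum χ, Complex.ofReal_tsum]
    refine tsum_congr fun n ↦ ?_
    rw [← sum_mul, hr]
    push_cast
    rfl
  have h3 : ((d.totient * (∑' n : ℕ, if (n : ZMod d) = 1 then w n else 0) : ℝ) : ℂ) =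
      ∑ χ : DirichletCharacter ℂ d, ∑' n : ℕ, χ n * (w n : ℂ) := by
    rw [← Summable.tsum_finsetSum fun χ _ ↦ hsum χ, ← tsum_mul_left, Complex.ofReal_tsum]
    refine tsum_congr fun n ↦ ?_
    rw [← sum_mul, sum_characters_eq]
    split_ifs <;> simp
  have h4 := sum_filter_add_sum_filter_not univ (fun χ : DirichletCharacter ℂ d ↦ χ ^ 2 = 1)
    fun χ ↦ ∑' n : ℕ, χ n * (w n : ℂ)
  rw [← h2, ← h3] at h4
  have h5 : ‖∑ χ : DirichletCharacter ℂ d with ¬ χ ^ 2 = 1, ∑' n : ℕ, χ n * (w n : ℂ)‖ ≤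
      d.totient * (j.factorial / (2 * η) ^ (j + 1)) := by
    refine (norm_sum_le_of_le _ fun χ hχ ↦ norm_tsum_mul_logWeight_le
      (by simpa using hχ) hl hdl hη0 hη j).trans ?_
    rw [sum_const, nsmul_eq_mul]
    gcongr
    refine (card_filter_le _ _).trans ?_
    rw [card_univ, ← Nat.card_eq_fintype_card, card_eq_totient_of_hasEnoughRootsOfUnity]
  rw [← sub_eq_iff_eq_add'.mpr h4.symm, ← Complex.ofReal_sub, Complex.norm_real,
    Real.norm_eq_abs] at h5
  have := (abs_le.mp h5).1
  linarith

end DirichletCharacter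

lemma summable_nonprime_vonMangoldt :
    Summable fun n : ℕ ↦ if n.Prime then 0 else vonMangoldt n * (n : ℝ) ^ (-(3 / 4) : ℝ) := by
  obtain ⟨f, hf⟩ : ∃ f : ℕ → ℝ, f = fun n ↦
    if n.Prime then 0 else vonMangoldt n * (n : ℝ) ^ (-(3 / 4) : ℝ) := ⟨_, rfl⟩
  rw [← hf]
  have hf0 n : 0 ≤ f n := by
    have := vonMangoldt_nonneg (n := n)
    rw [hf]; dsimp only; split_ifs <;> positivity
  set S : Set ℕ := {n | IsPrimePow n ∧ ¬ n.Prime} with hS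
  have hex (n : S) : ∃ p k : ℕ, p.Prime ∧ p ^ (k + 2) = n := by
    obtain ⟨n, hn, hn'⟩ := n
    obtain ⟨p, k, hp, hk, rfl⟩ := (isPrimePow_nat_iff _).mp hn
    obtain _ | _ | k := k
    · omega
    · simp [hp] at hn'
    · exact ⟨p, k, hp, rfl⟩
  choose p k hp hpk using hex
  have hinj : Function.Injective fun n : S ↦ (p n, k n) := by
    intro a b h
    simp only [Prod.mk.injEq] at h
    rw [Subtype.ext_iff, ← hpk a, ← hpk b, h.1, h.2]
  set θ : ℝ := 2 ^ (-(3 / 4) : ℝ) with hθ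
  have hθ0 : 0 < θ := by positivity
  have hθ1 : θ < 1 := Real.rpow_lt_one_of_one_lt_of_neg (by norm_num) (by norm_num)
  have hG : Summable fun x : ℕ × ℕ ↦ (8 * (x.1 : ℝ) ^ (-(11 / 8) : ℝ)) * θ ^ x.2 :=
    ((Real.summable_nat_rpow.mpr (by norm_num)).mul_left 8).mul_of_nonneg
      (summable_geometric_of_lt_one hθ0.le hθ1) (fun n ↦ by positivity) fun n ↦ by positivity
  have hle (n : S) : f n ≤ (8 * (p n : ℝ) ^ (-(11 / 8) : ℝ)) * θ ^ k n := by
    have hp0 : 0 < (p n : ℝ) := mod_cast (hp n).pos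
    have hp2 : (2 : ℝ) ≤ p n := mod_cast (hp n).two_le
    rw [hf]
    dsimp only
    rw [if_neg n.2.2, ← hpk n, vonMangoldt_apply_pow (by omega), vonMangoldt_apply_prime (hp n)]
    have h1 : Real.log (p n) ≤ 8 * (p n : ℝ) ^ (1 / 8 : ℝ) := by
      have := Real.log_le_rpow_div hp0.le (show (0 : ℝ) < 1 / 8 by norm_num)
      linarith
    have h2 : ((p n : ℝ) ^ (-(3 / 4) : ℝ)) ^ k n ≤ θ ^ k n := by
      refine pow_le_pow_left₀ (by positivity) ?_ _
      exact Real.rpow_le_rpow_of_nonpos (by norm_num) hp2 (by norm_num)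
    calc Real.log (p n) * ((p n ^ (k n + 2) : ℕ) : ℝ) ^ (-(3 / 4) : ℝ)
        ≤ 8 * (p n : ℝ) ^ (1 / 8 : ℝ) * ((p n ^ (k n + 2) : ℕ) : ℝ) ^ (-(3 / 4) : ℝ) := by gcongr
      _ = 8 * ((p n : ℝ) ^ (1 / 8 : ℝ) * ((p n : ℝ) ^ (-(3 / 4) : ℝ)) ^ 2) *
            ((p n : ℝ) ^ (-(3 / 4) : ℝ)) ^ k n := by
          push_cast
          rw [← Real.rpow_natCast_mul hp0.le, mul_comm _ (-(3 / 4) : ℝ), Real.rpow_mul hp0.le,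
            Real.rpow_natCast, pow_add]
          ring
      _ = 8 * (p n : ℝ) ^ (-(11 / 8) : ℝ) * ((p n : ℝ) ^ (-(3 / 4) : ℝ)) ^ k n := by
          rw [← Real.rpow_mul_natCast hp0.le, ← Real.rpow_add hp0]
          norm_num
      _ ≤ _ := by gcongr
  have hsub : Summable fun n : S ↦ f n :=
    (hG.comp_injective hinj).of_nonneg_of_le (fun n ↦ hf0 n) hle
  rw [← Set.indicator_eq_self (s := S) (f := f) |>.mpr ?_]
  · exact summable_subtype_iff_indicator.mp hsub
  intro n hn
  by_contra hnS
  refine hn ?_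
  by_cases hnp : n.Prime
  · simp [hf, hnp]
  · have : ¬ IsPrimePow n := fun h ↦ hnS ⟨h, hnp⟩
    simp [hf, vonMangoldt_eq_zero_iff.mpr this]

lemma exists_tsum_nonprime_logWeight_le :
    ∃ K : ℝ, 0 < K ∧ ∀ (j : ℕ) (η : ℝ), 0 < η →
      (∑' n : ℕ, if n.Prime then 0 else logWeight j (1 + η) n) ≤ j.factorial * 4 ^ j * K := by
  refine ⟨(∑' n : ℕ, if n.Prime then 0 else vonMangoldt n * (n : ℝ) ^ (-(3 / 4) : ℝ)) + 1,
    ?_, fun j η hη ↦ ?_⟩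
  · have : 0 ≤ ∑' n : ℕ, if n.Prime then 0 else vonMangoldt n * (n : ℝ) ^ (-(3 / 4) : ℝ) := by
      refine tsum_nonneg fun n ↦ ?_
      have := vonMangoldt_nonneg (n := n)
      split_ifs <;> positivity
    linarith
  · have hle (n : ℕ) : (if n.Prime then 0 else logWeight j (1 + η) n) ≤ j.factorial * 4 ^ j *
        (if n.Prime then 0 else vonMangoldt n * (n : ℝ) ^ (-(3 / 4) : ℝ)) := by
      split_ifs
      · simp
      have hΛ := vonMangoldt_nonneg (n := n)
      rcases n.eq_zero_or_pos with rfl | hn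
      · simp [logWeight]
      have hn0 : 0 < (n : ℝ) := mod_cast hn
      have hn1 : 1 ≤ (n : ℝ) := mod_cast hn
      have hlog : Real.log n ^ j ≤ j.factorial * 4 ^ j * (n : ℝ) ^ (1 / 4 : ℝ) := by
        have h := Real.pow_div_factorial_le_exp (Real.log n / 4)
          (by have := Real.log_nonneg hn1; positivity) j
        rw [div_pow, div_div, div_le_iff₀ (by positivity)] at h
        rw [Real.rpow_def_of_pos hn0, show Real.log n * (1 / 4) = Real.log n / 4 by ring]
        linarith
      calc logWeight j (1 + η) n
          ≤ vonMangoldt n * (j.factorial * 4 ^ j * (n : ℝ) ^ (1 / 4 : ℝ)) * (n : ℝ) ^ (-1 : ℝ) := by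
            rw [logWeight]
            have : (n : ℝ) ^ (-(1 + η)) ≤ (n : ℝ) ^ (-1 : ℝ) :=
              Real.rpow_le_rpow_of_exponent_le hn1 (by linarith)
            gcongr
        _ = j.factorial * 4 ^ j *
              (vonMangoldt n * ((n : ℝ) ^ (1 / 4 : ℝ) * (n : ℝ) ^ (-1 : ℝ))) := by
            ring
        _ = _ := by rw [← Real.rpow_add hn0]; norm_num
    have hs := summable_nonprime_vonMangoldt.mul_left ((j.factorial : ℝ) * 4 ^ j)
    have hs' : Summable fun n : ℕ ↦ if n.Prime then 0 else logWeight j (1 + η) n := by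
      refine hs.of_nonneg_of_le (fun n ↦ ?_) hle
      split_ifs
      exacts [le_rfl, logWeight_nonneg _ _ _]
    refine (Summable.tsum_le_tsum hle hs' hs).trans ?_
    rw [tsum_mul_left]
    gcongr
    linarith

lemma exists_le_tsum_prime_logWeight {M : ℕ} (hM : Odd M) :
    ∃ c > (0 : ℝ), ∃ C > (0 : ℝ), ∃ l₀ ≥ (2 : ℝ), ∀ l : ℝ, l₀ ≤ l → ∀ η : ℝ,
      2 ^ 40 * η * l ^ 9 = 1 → ∀ d B j : ℕ, d ∣ M ^ B → d ≤ Real.exp l → C * d ≤ 2 ^ j →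
        c * (j.factorial / η ^ (j + 1)) ≤
          d * ∑' n : ℕ, if n.Prime ∧ (n : ZMod d) = 1 then logWeight j (1 + η) n else 0 := by
  have : NeZero M := ⟨hM.pos.ne'⟩
  obtain ⟨c, hc, η₀, hη₀, hmain⟩ := exists_le_tsum_logWeight_residueClass M
  obtain ⟨K, hK, hnon⟩ := exists_tsum_nonprime_logWeight_le
  refine ⟨c / 2, by positivity, 4 * (1 + K) / c, by positivity, max 2 (1 / η₀), le_max_left _ _,
    fun l hl η hη d B j hd hdl hj ↦ ?_⟩
  have hl2 : 2 ≤ l := (le_max_left _ _).trans hl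
  have hl3 : 1 / η₀ ≤ l := (le_max_right _ _).trans hl
  have hηeq : η = 1 / (2 ^ 40 * l ^ 9) := by
    rw [eq_div_iff (by positivity)]; linarith
  have hη0 : 0 < η := by rw [hηeq]; positivity
  have hl9 : l ≤ l ^ 9 := le_self_pow₀ (by linarith) (by norm_num)
  have hηη₀ : η ≤ η₀ := by
    rw [hηeq, div_le_iff₀ (by positivity)]
    rw [div_le_iff₀ hη₀] at hl3
    have : l * η₀ ≤ l ^ 9 * η₀ := by gcongr
    have : 0 < l ^ 9 * η₀ := by positivity
    nlinarith
  have hη8 : η ≤ 1 / 8 := by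
    rw [hηeq, div_le_div_iff₀ (by positivity) (by positivity)]
    linarith
  have : NeZero d := ⟨by rintro rfl; simp [hM.pos.ne'] at hd⟩
  have h1 := hmain η hη0 hηη₀ j
  have h2 := DirichletCharacter.tsum_logWeight_residueClass_le hM hd hl2 hdl hη0 hη j
  have h3 := hnon j η hη0
  set w := logWeight j (1 + η) with hw
  have hw0 : ∀ n, 0 ≤ w n := logWeight_nonneg _ _
  have hws : Summable w := summable_logWeight j (by linarith)
  have hind (p : ℕ → Prop) [DecidablePred p] : Summable fun n ↦ if p n then w n else 0 :=
    hws.of_nonneg_of_le (fun n ↦ by split_ifs <;> simp [hw0])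
      fun n ↦ by split_ifs <;> simp [hw0]
  have hind' (p : ℕ → Prop) [DecidablePred p] : Summable fun n ↦ if p n then 0 else w n :=
    hws.of_nonneg_of_le (fun n ↦ by split_ifs <;> simp [hw0])
      fun n ↦ by split_ifs <;> simp [hw0]
  set P := ∑' n : ℕ, if n.Prime ∧ (n : ZMod d) = 1 then w n else 0 with hP
  have hP0 : 0 ≤ P := tsum_nonneg fun n ↦ by split_ifs <;> simp [hw0]
  have h4 : (∑' n : ℕ, if (n : ZMod d) = 1 then w n else 0) ≤ P + j.factorial * 4 ^ j * K := by
    refine le_trans ?_ (add_le_add_right h3 P)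
    rw [hP, ← (hind _).tsum_add (hind' _)]
    refine Summable.tsum_le_tsum (fun n ↦ ?_) (hind _) ((hind _).add (hind' _))
    by_cases hn : n.Prime <;> by_cases hn' : (n : ZMod d) = 1 <;> simp [hn, hn', hw0]
  have hφ : (d.totient : ℝ) ≤ d := mod_cast d.totient_le
  set Q : ℝ := j.factorial / η ^ (j + 1) with hQ
  have hQ0 : 0 < Q := by positivity
  have h5 : (d : ℝ) * (j.factorial / (2 * η) ^ (j + 1)) ≤ c / 4 * Q := by
    have : (j.factorial : ℝ) / (2 * η) ^ (j + 1) = Q / (2 * 2 ^ j) := by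
      rw [hQ, mul_pow, pow_succ 2]; field_simp
    rw [this, ← mul_div_assoc, div_le_iff₀ (by positivity)]
    have : (d : ℝ) ≤ c / 4 * 2 ^ j := by
      rw [div_mul_eq_mul_div, div_le_iff₀ hc] at hj
      have : 0 ≤ K * d := by positivity
      linarith
    nlinarith
  have h6 : (d : ℝ) * (j.factorial * 4 ^ j * K) ≤ c / 4 * Q := by
    have h7 : 4 ^ j * η ^ (j + 1) ≤ 1 / 2 ^ j := by
      calc 4 ^ j * η ^ (j + 1) ≤ 4 ^ j * (1 / 8) ^ (j + 1) := by gcongr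
        _ = (4 * (1 / 8)) ^ j * (1 / 8) := by rw [mul_pow, pow_succ]; ring
        _ ≤ (1 / 2) ^ j * 1 := by norm_num
        _ = 1 / 2 ^ j := by rw [mul_one, one_div_pow]
    have h8 : d * K ≤ c / 4 * 2 ^ j := by
      rw [div_mul_eq_mul_div, div_le_iff₀ hc] at hj
      have : 0 ≤ (d : ℝ) := by positivity
      linarith
    rw [hQ, ← mul_div_assoc, le_div_iff₀ (by positivity)]
    calc (d : ℝ) * (j.factorial * 4 ^ j * K) * η ^ (j + 1)
        = j.factorial * (d * K) * (4 ^ j * η ^ (j + 1)) := by ring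
      _ ≤ j.factorial * (c / 4 * 2 ^ j) * (1 / 2 ^ j) := by gcongr
      _ = _ := by field_simp
  have h9 : (d.totient : ℝ) * (∑' n : ℕ, if (n : ZMod d) = 1 then w n else 0) ≤
      d * (P + j.factorial * 4 ^ j * K) :=
    mul_le_mul hφ h4 (tsum_nonneg fun n ↦ by split_ifs <;> simp [hw0]) (by positivity)
  have h10 : (d.totient : ℝ) * (j.factorial / (2 * η) ^ (j + 1)) ≤
      d * (j.factorial / (2 * η) ^ (j + 1)) := by gcongr
  linarith

lemma logWeight_prime_le {d k : ℕ} (hd : 0 < d) (hk : 0 < k) (hp : (d * k + 1).Prime) {η : ℝ}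
    (hη : 0 < η) (j : ℕ) :
    d * logWeight j (1 + η) (d * k + 1) ≤
      3 * (j + 1).factorial / η ^ (j + 1) * (k : ℝ) ^ (-(1 + η / (j + 2))) := by
  set p := d * k + 1 with hpdef
  have hp0 : 0 < (p : ℝ) := mod_cast hp.pos
  have hd0 : 0 < (d : ℝ) := mod_cast hd
  have hk0 : 0 < (k : ℝ) := mod_cast hk
  have hpr : (p : ℝ) = d * k + 1 := by rw [hpdef]; push_cast; ring
  have hkp : (k : ℝ) ≤ p := by
    have : 1 ≤ d := hd
    exact_mod_cast show k ≤ p by nlinarith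
  set η' : ℝ := η * ((j + 1) / (j + 2)) with hη'
  have hη'0 : 0 < η' := by positivity
  have hlog : Real.log p ^ (j + 1) ≤ 3 * (j + 1).factorial / η ^ (j + 1) * (p : ℝ) ^ η' := by
    have h := Real.pow_div_factorial_le_exp (Real.log p * η')
      (by have := Real.log_natCast_nonneg p; positivity) (j + 1)
    rw [← Real.rpow_def_of_pos hp0, mul_pow, div_le_iff₀ (by positivity), hη', mul_pow] at h
    have he : ((j + 2 : ℝ) / (j + 1)) ^ (j + 1) ≤ 3 := by
      have h1 : ((j + 2 : ℝ) / (j + 1)) ≤ Real.exp (1 / (j + 1)) := by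
        have := Real.add_one_le_exp (1 / (j + 1 : ℝ))
        calc ((j + 2 : ℝ) / (j + 1)) = 1 / (j + 1) + 1 := by field_simp; ring
          _ ≤ _ := this
      calc ((j + 2 : ℝ) / (j + 1)) ^ (j + 1) ≤ Real.exp (1 / (j + 1)) ^ (j + 1) := by gcongr
        _ = Real.exp 1 := by
          rw [← Real.exp_nat_mul]
          congr 1
          push_cast
          field_simp
        _ ≤ 3 := by linarith [Real.exp_one_lt_d9]
    have hinv : ((j + 1 : ℝ) / (j + 2)) ^ (j + 1) * ((j + 2 : ℝ) / (j + 1)) ^ (j + 1) = 1 := by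
      rw [← mul_pow]
      have : ((j + 1 : ℝ) / (j + 2)) * ((j + 2 : ℝ) / (j + 1)) = 1 := by field_simp
      rw [this, one_pow]
    rw [div_mul_eq_mul_div, le_div_iff₀ (by positivity)]
    calc Real.log p ^ (j + 1) * η ^ (j + 1)
        = Real.log p ^ (j + 1) * η ^ (j + 1) * (((j + 1 : ℝ) / (j + 2)) ^ (j + 1) *
            ((j + 2 : ℝ) / (j + 1)) ^ (j + 1)) := by rw [hinv, mul_one]
      _ = (Real.log p ^ (j + 1) * (η ^ (j + 1) * ((j + 1 : ℝ) / (j + 2)) ^ (j + 1))) *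
            ((j + 2 : ℝ) / (j + 1)) ^ (j + 1) := by ring
      _ ≤ ((p : ℝ) ^ η' * (j + 1).factorial) * 3 := by gcongr
      _ = _ := by ring
  have hsplit : (p : ℝ) ^ η' * (p : ℝ) ^ (-(1 + η)) =
      (p : ℝ)⁻¹ * (p : ℝ) ^ (-(η / (j + 2))) := by
    rw [← Real.rpow_neg_one, ← Real.rpow_add hp0, ← Real.rpow_add hp0, hη']
    congr 1
    field_simp
    ring
  have hdp : (d : ℝ) * (p : ℝ)⁻¹ ≤ (k : ℝ)⁻¹ := by
    rw [← div_eq_mul_inv, ← one_div, div_le_div_iff₀ hp0 hk0]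
    linarith
  have hpow : (p : ℝ) ^ (-(η / (j + 2))) ≤ (k : ℝ) ^ (-(η / (j + 2))) :=
    Real.rpow_le_rpow_of_nonpos hk0 hkp (by rw [neg_nonpos]; positivity)
  calc d * logWeight j (1 + η) p = d * (Real.log p ^ (j + 1) * (p : ℝ) ^ (-(1 + η))) := by
        rw [logWeight, vonMangoldt_apply_prime hp, pow_succ]; ring
    _ ≤ d * (3 * (j + 1).factorial / η ^ (j + 1) * (p : ℝ) ^ η' * (p : ℝ) ^ (-(1 + η))) := by
        gcongr
    _ = 3 * (j + 1).factorial / η ^ (j + 1) * ((d * (p : ℝ)⁻¹) * (p : ℝ) ^ (-(η / (j + 2)))) := by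
        rw [mul_assoc _ ((p : ℝ) ^ η'), hsplit]; ring
    _ ≤ 3 * (j + 1).factorial / η ^ (j + 1) * ((k : ℝ)⁻¹ * (k : ℝ) ^ (-(η / (j + 2)))) := by
        gcongr
    _ = _ := by rw [← Real.rpow_neg_one, ← Real.rpow_add hk0, neg_add]

open Finset in
lemma sum_tsum_prime_logWeight_le {ι : Type*} (s : Finset ι) (d : ι → ℕ)
    (hd : ∀ i ∈ s, 0 < d i)
    (hs : ∀ i ∈ s, ∀ i' ∈ s, ∀ k, 0 < k → (d i * k + 1).Prime → (d i' * k + 1).Prime → i = i')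
    {η : ℝ} (hη : 0 < η) (hη1 : η ≤ 1) (j : ℕ) :
    ∑ i ∈ s, d i * (∑' n : ℕ, if n.Prime ∧ (n : ZMod (d i)) = 1 then
      logWeight j (1 + η) n else 0) ≤ 6 * (j + 1).factorial * (j + 2) / η ^ (j + 2) := by
  set w := logWeight j (1 + η) with hw
  have hw0 : ∀ n, 0 ≤ w n := logWeight_nonneg _ _
  have hws : Summable w := summable_logWeight j (by linarith)
  have hinj {i : ι} (hi : i ∈ s) : Function.Injective fun k ↦ d i * k + 1 := by
    intro a b h
    have := hd i hi
    simpa [this.ne'] using h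
  have hre {i : ι} (hi : i ∈ s) :
      (∑' n : ℕ, if n.Prime ∧ (n : ZMod (d i)) = 1 then w n else 0) =
        ∑' k : ℕ, if (d i * k + 1).Prime then w (d i * k + 1) else 0 := by
    rw [← (hinj hi).tsum_eq]
    · refine tsum_congr fun k ↦ ?_
      simp
    · intro n hn
      rw [Function.mem_support, ne_eq, ite_eq_right_iff, Classical.not_imp] at hn
      have h1 : ((1 : ℕ) : ZMod (d i)) = (n : ZMod (d i)) := by simp [hn.1.2]
      rw [ZMod.natCast_eq_natCast_iff, Nat.modEq_iff_dvd' hn.1.1.one_le] at h1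
      obtain ⟨k, hk⟩ := h1
      refine ⟨k, ?_⟩
      have := hn.1.1.one_le
      dsimp only
      omega
  have hsum {i : ι} (hi : i ∈ s) :
      Summable fun k : ℕ ↦ d i * (if (d i * k + 1).Prime then w (d i * k + 1) else 0) := by
    refine Summable.mul_left _ ((hws.comp_injective (hinj hi)).of_nonneg_of_le
      (fun k ↦ ?_) fun k ↦ ?_) <;> split_ifs <;> simp [hw0]
  rw [sum_congr rfl fun i hi ↦ by rw [hre hi, ← tsum_mul_left],
    ← Summable.tsum_finsetSum fun i hi ↦ hsum hi]
  have hε : 0 < η / (j + 2) := by positivity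
  have hε1 : η / (j + 2) ≤ 1 := by
    rw [div_le_one (by positivity)]
    have : (0 : ℝ) ≤ j := by positivity
    linarith
  have hle (k : ℕ) : ∑ i ∈ s, d i * (if (d i * k + 1).Prime then w (d i * k + 1) else 0) ≤
      3 * (j + 1).factorial / η ^ (j + 1) * (k : ℝ) ^ (-(1 + η / (j + 2))) := by
    by_cases h : ∃ i ∈ s, 0 < k ∧ (d i * k + 1).Prime
    · obtain ⟨i, hi, hk, hp⟩ := h
      rw [sum_eq_single_of_mem i hi fun i' hi' hne ↦ ?_, if_pos hp]
      · exact logWeight_prime_le (hd i hi) hk hp hη j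
      · rw [if_neg fun hp' ↦ hne (hs i' hi' i hi k hk hp' hp), mul_zero]
    · rw [sum_eq_zero fun i hi ↦ ?_]
      · positivity
      · rw [if_neg, mul_zero]
        intro hp
        refine h ⟨i, hi, Nat.pos_of_ne_zero ?_, hp⟩
        rintro rfl
        simp [Nat.not_prime_one] at hp
  refine (Summable.tsum_le_tsum hle (summable_sum fun i hi ↦ hsum hi)
    ((summable_natCast_rpow_neg_one_add hε).mul_left _)).trans ?_
  rw [tsum_mul_left]
  calc 3 * (j + 1).factorial / η ^ (j + 1) * ∑' k : ℕ, (k : ℝ) ^ (-(1 + η / (j + 2)))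
      ≤ 3 * (j + 1).factorial / η ^ (j + 1) * (2 / (η / (j + 2))) := by
        gcongr
        exact tsum_natCast_rpow_neg_one_add_le hε hε1
    _ = _ := by rw [pow_succ η (j + 1)]; field_simp; ring

lemma IsCarmichael.sub_one_dvd {n q : ℕ} (h : IsCarmichael n) (hq : q.Prime) (hqn : q ∣ n) :
    q - 1 ∣ n - 1 := by
  have : Fact q.Prime := ⟨hq⟩
  obtain ⟨u, hu⟩ := IsCyclic.exists_ofOrder_eq_natCard (α := (ZMod q)ˣ)
  rw [Nat.card_eq_fintype_card, ZMod.card_units] at hu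
  rw [← hu]
  refine orderOf_dvd_of_pow_eq_one ?_
  have h1 := ((h.2.2 ((u : ZMod q).val : ℤ)).of_dvd (m := q) (by exact_mod_cast hqn))
  rw [← ZMod.intCast_eq_intCast_iff] at h1
  push_cast at h1
  rw [ZMod.natCast_zmod_val, ← Units.val_pow_eq_pow_val] at h1
  have h2 : u ^ n = u := Units.ext h1
  refine mul_right_cancel (b := u) ?_
  rw [← pow_succ, Nat.sub_add_cancel h.1.le, h2, one_mul]

lemma not_isCarmichael_mul {p q : ℕ} (hp : p.Prime) (hq : q.Prime) (hpq : p ≠ q) :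
    ¬ IsCarmichael (p * q) := by
  wlog hlt : p < q generalizing p q
  · rw [mul_comm]
    exact this hq hp hpq.symm (by omega)
  intro h
  have h1 := h.sub_one_dvd hq (Dvd.intro_left p rfl)
  obtain ⟨a, rfl⟩ := Nat.exists_eq_add_of_le' hp.two_le
  obtain ⟨b, rfl⟩ := Nat.exists_eq_add_of_le' hq.two_le
  have h2 : (a + 2) * (b + 2) - 1 = (b + 2 - 1) * (a + 2) + (a + 1) := by
    rw [Nat.sub_eq_iff_eq_add (by nlinarith), show b + 2 - 1 = b + 1 by omega]
    ring
  rw [h2, Nat.dvd_add_right (Dvd.intro _ rfl)] at h1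
  have := Nat.le_of_dvd (by omega) h1
  omega

lemma rad_totient_mul_dvd {p q : ℕ} (hp : p.Prime) (hq : q.Prime) (hpq : p ≠ q)
    (h : (p - 1).primeFactors = (q - 1).primeFactors) :
    rad (Nat.totient (p * q)) ∣ p * q - 1 := by
  have hp1 := hp.two_le
  have hq1 := hq.two_le
  rw [Nat.totient_mul ((Nat.coprime_primes hp hq).mpr hpq), Nat.totient_prime hp,
    Nat.totient_prime hq, rad, Nat.primeFactors_mul (by omega) (by omega), ← h, Finset.union_self]
  have h1 := Nat.prod_primeFactors_dvd (p - 1)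
  have h2 := Nat.prod_primeFactors_dvd (q - 1)
  rw [← h] at h2
  have h3 : p * q - 1 = (p - 1) * q + (q - 1) := by
    rw [Nat.sub_mul, one_mul]
    have : q ≤ p * q := Nat.le_mul_of_pos_left _ hp.pos
    omega
  rw [h3]
  exact dvd_add (dvd_mul_of_dvd_left h1 q) h2

/-- Products of powers of the elements of `P` have the exponents as invariants. -/
lemma prod_prime_pow_injective {P : Finset ℕ} (hP : ∀ q ∈ P, q.Prime) :
    Function.Injective fun a : P → ℕ ↦ ∏ q : P, (q : ℕ) ^ a q := by
  have key (a : P → ℕ) (q : P) : (∏ x : P, (x : ℕ) ^ a x).factorization q = a q := by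
    rw [Nat.factorization_prod fun (x : P) _ ↦ pow_ne_zero _ (hP x x.2).ne_zero,
      Finsupp.finsetSum_apply, Finset.sum_eq_single q]
    · simp [(hP q q.2).factorization_pow]
    · intro x _ hx
      rw [(hP x x.2).factorization_pow, Finsupp.single_eq_of_ne]
      exact fun h ↦ hx (Subtype.ext h.symm)
    · simp
  intro a b h
  ext q
  rw [← key a, ← key b]
  exact congrArg (fun n : ℕ ↦ n.factorization q) h

open Finset in
lemma exists_primes_primeFactors_sub_one_eq (N : ℕ) :
    ∃ p q : ℕ, p.Prime ∧ q.Prime ∧ p ≠ q ∧ N < p ∧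
      (p - 1).primeFactors = (q - 1).primeFactors := by
  by_contra! hcon
  obtain ⟨P, hP, hcard⟩ : ∃ P : Finset ℕ, (∀ q ∈ P, q.Prime ∧ q ≠ 2) ∧ #P = 12 := by
    obtain ⟨P, hP, hcard⟩ :=
      (Nat.infinite_setOfPred_prime.sdiff (Set.finite_singleton 2)).exists_subset_card_eq 12
    exact ⟨P, fun q hq ↦ by simpa using hP hq, hcard⟩
  set M := ∏ q : P, (q : ℕ) with hM
  have hModd : Odd M := by
    rw [hM]
    exact prod_induction _ _ (fun _ _ ↦ Odd.mul) odd_one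
      fun q _ ↦ (hP q q.2).1.odd_of_ne_two (hP q q.2).2
  have hM0 : 0 < M := hModd.pos
  have hM2 : 2 ≤ M := by
    obtain ⟨q, hq⟩ : P.Nonempty := card_pos.mp (by omega)
    exact (hP q hq).1.two_le.trans (Nat.le_of_dvd hM0
      (dvd_prod_of_mem (fun q : P ↦ (q : ℕ)) (mem_univ ⟨q, hq⟩)))
  obtain ⟨c, hc, C, hC, l₀, hl₀, hmain⟩ := exists_le_tsum_prime_logWeight hModd
  obtain ⟨c₀, hc₀⟩ := exists_nat_ge C
  have hM0' : 0 < (M : ℝ) := mod_cast hM0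
  obtain ⟨A, hA⟩ := exists_nat_gt (N + (c₀ + 2) + l₀ + 24 * 2 ^ 40 * (2 * M) ^ 11 / c : ℝ)
  have hD0 : 0 ≤ 24 * 2 ^ 40 * (2 * M) ^ 11 / c := by positivity
  have hN0 : (0 : ℝ) ≤ N := by positivity
  have hc0 : (0 : ℝ) ≤ c₀ := by positivity
  have hAN : N < A := by
    have : (N : ℝ) < A := by linarith
    exact_mod_cast this
  have hA0 : 0 < A := by omega
  have hA0' : (0 : ℝ) < A := mod_cast hA0
  set l : ℝ := 2 * A * M with hl
  have hM2' : (2 : ℝ) ≤ M := mod_cast hM2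
  have hAl : 2 * A ≤ l := by rw [hl]; nlinarith
  have hll : l₀ ≤ l := by linarith
  have hl0 : 0 < l := by linarith
  set η : ℝ := 1 / (2 ^ 40 * l ^ 9) with hη
  have hη0 : 0 < η := by positivity
  have hηl : 2 ^ 40 * η * l ^ 9 = 1 := by rw [hη]; field_simp
  have hη1 : η ≤ 1 := by
    rw [hη, div_le_one (by positivity)]
    have : (1 : ℝ) ≤ l ^ 9 := one_le_pow₀ (by linarith)
    linarith
  set j : ℕ := 2 * A * M + c₀ with hj
  have hjl : (j : ℝ) + 2 ≤ 2 * l := by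
    rw [hj]; push_cast; linarith
  set s : Finset (P → ℕ) := Fintype.piFinset fun _ ↦ Ico A (2 * A) with hs
  have hscard : (#s : ℝ) = A ^ 12 := by
    rw [hs, Fintype.card_piFinset, prod_const, Nat.card_Ico, card_univ, Fintype.card_coe, hcard,
      show 2 * A - A = A by omega, Nat.cast_pow]
  set d : (P → ℕ) → ℕ := fun a ↦ ∏ q : P, (q : ℕ) ^ a q with hd
  have hmem {a : P → ℕ} (ha : a ∈ s) (q : P) : A ≤ a q ∧ a q < 2 * A := by
    rw [hs, Fintype.mem_piFinset] at ha
    simpa using ha q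
  have hdvd {a : P → ℕ} (ha : a ∈ s) : M ^ A ∣ d a := by
    rw [hM, ← prod_pow]
    exact prod_dvd_prod_of_dvd _ _ fun q _ ↦ pow_dvd_pow _ (hmem ha q).1
  have hdvd' {a : P → ℕ} (ha : a ∈ s) : d a ∣ M ^ (2 * A) := by
    rw [hM, ← prod_pow]
    exact prod_dvd_prod_of_dvd _ _ fun q _ ↦ pow_dvd_pow _ (hmem ha q).2.le
  have hd0 {a : P → ℕ} (ha : a ∈ s) : 0 < d a := Nat.pos_of_dvd_of_pos (hdvd' ha) (by positivity)
  have hprime {a : P → ℕ} (ha : a ∈ s) : (d a).primeFactors = M.primeFactors := by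
    refine le_antisymm ?_ ?_
    · rw [← Nat.primeFactors_pow M (show 2 * A ≠ 0 by omega)]
      exact Nat.primeFactors_mono (hdvd' ha) (by positivity)
    · rw [← Nat.primeFactors_pow M hA0.ne']
      exact Nat.primeFactors_mono (hdvd ha) (hd0 ha).ne'
  have hunique : ∀ a ∈ s, ∀ b ∈ s, ∀ k, 0 < k → (d a * k + 1).Prime → (d b * k + 1).Prime →
      a = b := by
    intro a ha b hb k hk hpa hpb
    refine prod_prime_pow_injective (fun q hq ↦ (hP q hq).1) (?_ : d a = d b)
    by_contra hne
    refine hcon _ _ hpa hpb (fun h ↦ hne ?_) ?_ ?_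
    · exact Nat.eq_of_mul_eq_mul_right hk (by omega)
    · have h1 : A < 2 ^ A := Nat.lt_two_pow_self
      have h2 : 2 ^ A ≤ M ^ A := Nat.pow_le_pow_left hM2 A
      have h3 : M ^ A ≤ d a := Nat.le_of_dvd (hd0 ha) (hdvd ha)
      have h4 : d a ≤ d a * k := Nat.le_mul_of_pos_right _ hk
      omega
    · rw [Nat.add_sub_cancel, Nat.add_sub_cancel, Nat.primeFactors_mul (hd0 ha).ne' hk.ne',
        Nat.primeFactors_mul (hd0 hb).ne' hk.ne', hprime ha, hprime hb]
  have hdle {a : P → ℕ} (ha : a ∈ s) : (d a : ℝ) ≤ (M : ℝ) ^ (2 * A) := by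
    exact_mod_cast Nat.le_of_dvd (by positivity) (hdvd' ha)
  have hlow : ∀ a ∈ s, c * (j.factorial / η ^ (j + 1)) ≤ d a *
      ∑' n : ℕ, if n.Prime ∧ (n : ZMod (d a)) = 1 then logWeight j (1 + η) n else 0 := by
    intro a ha
    refine hmain l hll η hηl (d a) (2 * A) j (hdvd' ha) ((hdle ha).trans ?_) ?_
    · rw [hl, mul_comm _ (M : ℝ)]
      rw [show (M : ℝ) * (2 * A) = ((2 * A : ℕ) : ℝ) * M by push_cast; ring, Real.exp_nat_mul]
      gcongr
      linarith [Real.add_one_le_exp (M : ℝ)]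
    · have h1 : C ≤ 2 ^ c₀ := hc₀.trans (mod_cast Nat.lt_two_pow_self.le)
      have h2 : (M : ℝ) ≤ 2 ^ M := mod_cast Nat.lt_two_pow_self.le
      calc C * d a ≤ 2 ^ c₀ * ((2 : ℝ) ^ M) ^ (2 * A) := by
            gcongr
            exact (hdle ha).trans (by gcongr)
        _ = 2 ^ j := by rw [hj, ← pow_mul, ← pow_add]; congr 1; ring
  have hup := sum_tsum_prime_logWeight_le s d (fun a ha ↦ hd0 ha) hunique hη0 hη1 j
  have hlow' := card_nsmul_le_sum s _ _ hlow
  rw [nsmul_eq_mul, hscard] at hlow'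
  have h1 := hlow'.trans hup
  have h2 : (A : ℝ) ^ 12 * c ≤ 6 * (j + 1) * (j + 2) / η := by
    have hQ : 0 < (j.factorial : ℝ) / η ^ (j + 1) := by positivity
    refine le_of_mul_le_mul_right ?_ hQ
    rw [mul_assoc]
    refine h1.trans_eq ?_
    rw [Nat.factorial_succ, pow_succ η (j + 1)]
    push_cast
    field_simp
  have h3 : 6 * (j + 1) * (j + 2) / η ≤ 24 * 2 ^ 40 * (2 * M) ^ 11 * (A : ℝ) ^ 11 := by
    have : 6 * (j + 1) * (j + 2) / η = 6 * ((j + 1) * (j + 2)) * (2 ^ 40 * l ^ 9) := by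
      rw [hη, div_div_eq_mul_div, div_one]; ring
    rw [this]
    calc 6 * ((j + 1) * (j + 2)) * (2 ^ 40 * l ^ 9)
        ≤ 6 * ((2 * l) * (2 * l)) * (2 ^ 40 * l ^ 9) := by gcongr; linarith
      _ = 24 * 2 ^ 40 * l ^ 11 := by ring
      _ = _ := by rw [hl]; ring
  have h4 : (A : ℝ) * c ≤ 24 * 2 ^ 40 * (2 * M) ^ 11 := by
    refine le_of_mul_le_mul_right ?_ (show 0 < (A : ℝ) ^ 11 by positivity)
    calc (A : ℝ) * c * A ^ 11 = A ^ 12 * c := by ring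
      _ ≤ _ := h2.trans h3
  have h5 : 24 * 2 ^ 40 * (2 * M) ^ 11 / c < A := by linarith
  rw [div_lt_iff₀ hc] at h5
  linarith

/-- There are infinitely many composite natural numbers `n` with
`rad (φ n) ∣ n - 1` that are not Carmichael numbers. -/
theorem infinitely_many_radimichael_not_carmichael :
    {n : ℕ | 1 < n ∧ ¬ n.Prime ∧ rad (Nat.totient n) ∣ n - 1 ∧ ¬ IsCarmichael n}.Infinite := by
  refine Set.infinite_of_forall_exists_gt fun N ↦ ?_
  obtain ⟨p, q, hp, hq, hpq, hN, h⟩ := exists_primes_primeFactors_sub_one_eq N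
  have hlt : p < p * q := lt_mul_of_one_lt_right hp.pos hq.one_lt
  exact ⟨p * q, ⟨hp.one_lt.trans hlt, Nat.not_prime_mul hp.ne_one hq.ne_one,
    rad_totient_mul_dvd hp hq hpq h, not_isCarmichael_mul hp hq hpq⟩, hN.trans hlt⟩
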